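/- Let R be an order in an étale ℚ-algebra K. Then R is a Bass order (every over-order of R is Gorenstein) if and only if the ideal class monoid ICM(R) is a Clifford monoid, i.e. a disjoint union of groups; concretely, R is Bass if and only if for every fractional R-ideal I there exist a fractional R-ideal J and x ∈ K^× such that I = x·I²·J. -/

import Mathlib

/-!
Setting: `K` is an étale `ℚ`-algebra (a commutative `ℚ`-algebra, reduced and
finite-dimensional over `ℚ`), and `R` is an order in `K`: a subring of `K`
(equivalently a `ℤ`-subalgebra) that is finitely generated as a `ℤ`-module and
spans `K` over `ℚ`.  A fractional `R`-ideal is a finitely generated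
`R`-submodule of `K` spanning `K` over `ℚ`.
-/

open Submodule

variable {K : Type*} [CommRing K] [Algebra ℚ K]
variable {R : Subalgebra ℤ K}

/-- The ideal quotient `(I : J) = {x ∈ K | x·J ⊆ I}`. -/
def colonSub (I J : Submodule ↥R K) : Submodule ↥R K where
  carrier := {x : K | ∀ y ∈ J, x * y ∈ I}
  zero_mem' := fun y _ => by simp [I.zero_mem]
  add_mem' := fun {a b} ha hb y hy => by
    simpa [add_mul] using I.add_mem (ha y hy) (hb y hy)
  smul_mem' := fun c x hx y hy => by
    simpa [smul_mul_assoc] using I.smul_mem c (hx y hy)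

/-- The trace dual `I^t = {x ∈ K | Tr_{K/ℚ}(x·I) ⊆ ℤ}`, where `Tr_{K/ℚ}(z)` is the
trace of the `ℚ`-linear endomorphism `y ↦ z·y` of `K`. -/
def traceDualSub (I : Submodule ↥R K) : Submodule ↥R K where
  carrier := {x : K | ∀ y ∈ I, ∃ n : ℤ, Algebra.trace ℚ K (x * y) = (n : ℚ)}
  zero_mem' := fun y _ => ⟨0, by simp⟩
  add_mem' := fun {a b} ha hb y hy => by
    obtain ⟨n, hn⟩ := ha y hy
    obtain ⟨m, hm⟩ := hb y hy
    refine ⟨n + m, ?_⟩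
    rw [add_mul, map_add, hn, hm]
    push_cast
    ring
  smul_mem' := fun c x hx y hy => by
    obtain ⟨n, hn⟩ := hx (c • y) (I.smul_mem c hy)
    refine ⟨n, ?_⟩
    rw [← hn]
    congr 1
    rw [Algebra.smul_def, Algebra.smul_def]
    ring

open Module in
theorem aux_nondeg [FiniteDimensional ℚ K] [IsReduced K] :
    (Algebra.traceForm ℚ K).Nondegenerate := by
  have hs := Algebra.traceForm_isSymm (R := ℚ) (S := K)
  refine hs.isRefl.nondegenerate_iff_separatingLeft.mpr ?_
  intro x hx
  have : IsArtinianRing K := IsArtinianRing.of_finite ℚ K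
  obtain ⟨n, y, hy⟩ := IsArtinian.exists_pow_succ_smul_dvd x (1 : K)
  have h1 : x * (1 - x * y) = 0 := by
    apply IsReduced.eq_zero
    refine ⟨n + 1, ?_⟩
    simp only [smul_eq_mul, Nat.succ_eq_add_one, mul_one] at hy
    have : x ^ n * (1 - x * y) = 0 := by linear_combination -hy
    rw [mul_pow, pow_succ, pow_succ]
    linear_combination (x * (1 - x * y) ^ n) * this
  have he : IsIdempotentElem (x * y) := by
    unfold IsIdempotentElem
    linear_combination -y * h1
  have he' : IsIdempotentElem (Algebra.lmul ℚ K (x * y)) := he.map _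
  have h0 : LinearMap.trace ℚ K (Algebra.lmul ℚ K (x * y)) = 0 := by
    have := hx y
    rwa [Algebra.traceForm_apply, Algebra.trace_apply] at this
  have h2 := LinearMap.IsIdempotentElem.eq_zero_of_trace_eq_zero he' h0
  have h3 : x * y = 0 := by simpa using congrArg (fun f => f 1) h2
  rw [h3] at h1
  simpa using h1

theorem aux_restrict (I : Submodule ↥R K) :
    (traceDualSub I).restrictScalars ℤ =
      (Algebra.traceForm ℚ K).dualSubmodule (I.restrictScalars ℤ) := by
  ext x
  simp only [Submodule.restrictScalars_mem, LinearMap.BilinForm.mem_dualSubmodule,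
    Submodule.mem_one, Algebra.traceForm_apply]
  constructor
  · intro h y hy
    obtain ⟨n, hn⟩ := h y hy
    exact ⟨n, by simpa using hn.symm⟩
  · intro h y hy
    obtain ⟨n, hn⟩ := h y hy
    exact ⟨n, by simpa using hn.symm⟩

theorem aux_basis [FiniteDimensional ℚ K] (hRfin : Module.Finite ℤ R)
    (I : Submodule ↥R K) (hI : I.FG) (hI' : Submodule.span ℚ (I : Set K) = ⊤) :
    ∃ (n : ℕ) (b : Module.Basis (Fin n) ℚ K),
      I.restrictScalars ℤ = Submodule.span ℤ (Set.range b) := by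
  have hfg : (I.restrictScalars ℤ).FG := hI.restrictScalars
  have : Submodule.IsLattice ℚ (I.restrictScalars ℤ) := ⟨hfg, hI'⟩
  have : Module.Free ℤ (I.restrictScalars ℤ) := Submodule.IsLattice.free ℚ _
  let b := Module.finBasis ℤ (I.restrictScalars ℤ)
  refine ⟨_, b.extendOfIsLattice ℚ, ?_⟩
  have : Set.range (b.extendOfIsLattice ℚ) =
      (I.restrictScalars ℤ).subtype '' Set.range b := by
    rw [← Set.range_comp]
    congr 1
    ext i
    simp
  rw [this, ← Submodule.map_span, b.span_eq, Submodule.map_top, Submodule.range_subtype]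

theorem aux_dual [FiniteDimensional ℚ K] [IsReduced K] (hRfin : Module.Finite ℤ R)
    (I : Submodule ↥R K) (hI : I.FG) (hI' : Submodule.span ℚ (I : Set K) = ⊤) :
    (traceDualSub I).FG ∧ Submodule.span ℚ (traceDualSub I : Set K) = ⊤ ∧
      traceDualSub (traceDualSub I) = I := by
  obtain ⟨n, b, hb⟩ := aux_basis hRfin I hI hI'
  have hr := aux_restrict I
  have hr2 := aux_restrict (traceDualSub I)
  rw [hb] at hr
  rw [hr, LinearMap.BilinForm.dualSubmodule_dualSubmodule_of_basis _ aux_nondeg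
    (Algebra.traceForm_isSymm (R := ℚ) (S := K)), ← hb] at hr2
  rw [LinearMap.BilinForm.dualSubmodule_span_of_basis _ aux_nondeg] at hr
  refine ⟨?_, ?_, ?_⟩
  · apply Submodule.FG.of_restrictScalars ℤ
    rw [hr]
    exact Submodule.fg_span (Set.finite_range _)
  · have : (traceDualSub I : Set K) = ((traceDualSub I).restrictScalars ℤ : Set K) := rfl
    rw [this, hr, Submodule.span_span_of_tower, Module.Basis.span_eq]
  · exact Submodule.restrictScalars_injective ℤ _ _ hr2

theorem aux_span_mul (I J : Submodule ↥R K) (hI : Submodule.span ℚ (I : Set K) = ⊤)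
    (hJ : Submodule.span ℚ (J : Set K) = ⊤) :
    Submodule.span ℚ ((I * J : Submodule ↥R K) : Set K) = ⊤ := by
  rw [eq_top_iff]
  have h : Submodule.span ℚ (I : Set K) * Submodule.span ℚ (J : Set K) = ⊤ := by
    rw [hI, hJ, eq_top_iff]
    intro x _
    simpa using Submodule.mul_mem_mul (Submodule.mem_top (R := ℚ) (x := x))
      (Submodule.mem_top (R := ℚ) (x := (1 : K)))
  rw [← h, Submodule.span_mul_span]
  apply Submodule.span_mono
  rintro _ ⟨a, ha, b, hb, rfl⟩
  exact Submodule.mul_mem_mul ha hb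

theorem aux_dual_mul (I J : Submodule ↥R K) :
    traceDualSub (I * J) = colonSub (traceDualSub I) J := by
  ext x
  constructor
  · intro h y hy z hz
    have := h (z * y) (Submodule.mul_mem_mul hz hy)
    rwa [show x * y * z = x * (z * y) by ring]
  · intro h z hz
    induction hz using Submodule.mul_induction_on' with
    | mem_mul_mem a ha b hb =>
      have := h b hb a ha
      rwa [show x * (a * b) = x * b * a by ring]
    | add a _ b _ iha ihb =>
      obtain ⟨n, hn⟩ := iha
      obtain ⟨m, hm⟩ := ihb
      exact ⟨n + m, by rw [mul_add, map_add, hn, hm]; push_cast; rfl⟩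

theorem aux_map (x : K) (M : Submodule ↥R K) :
    Submodule.map (LinearMap.mulLeft R x) M = Submodule.span R {x} * M := by
  ext y
  rw [Submodule.mem_span_singleton_mul]
  simp [Submodule.mem_map]

theorem aux_colon_mul (I J : Submodule ↥R K) : J * colonSub I J ≤ I := by
  rw [Submodule.mul_le]
  intro a ha b hb
  rw [mul_comm]
  exact hb a ha

theorem aux_one_mem (S I E : Submodule ↥R K) (h1 : (1 : K) ∈ S) (hSS : S * S ≤ S)
    (hI : I.FG) (hI' : Submodule.span ℚ (I : Set K) = ⊤)
    (hSI : S * I ≤ I) (hSE : S * E ≤ E) (hES : E ≤ S) (hIE : I ≤ E * I) :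
    (1 : K) ∈ E := by
  let A : Subalgebra ↥R K := S.toSubalgebra h1
    (fun x y hx hy => hSS (Submodule.mul_mem_mul hx hy))
  let N : Submodule A K :=
    { carrier := I
      add_mem' := fun ha hb => I.add_mem ha hb
      zero_mem' := I.zero_mem
      smul_mem' := fun c x hx => hSI (Submodule.mul_mem_mul c.2 hx) }
  let e : Ideal A :=
    { carrier := {a | (a : K) ∈ E}
      add_mem' := fun ha hb => E.add_mem ha hb
      zero_mem' := E.zero_mem
      smul_mem' := fun c x hx => hSE (Submodule.mul_mem_mul c.2 hx) }
  have hN : N.FG := by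
    apply Submodule.FG.of_restrictScalars R
    have : N.restrictScalars R = I := by ext; rfl
    rwa [this]
  have hle : N ≤ e • N := by
    intro x hx
    have hx' : x ∈ E * I := hIE hx
    clear hx
    induction hx' using Submodule.mul_induction_on' with
    | mem_mul_mem a ha b hb =>
      exact Submodule.smul_mem_smul (r := (⟨a, hES ha⟩ : A)) (show _ ∈ E from ha) (show b ∈ I from hb)
    | add a _ b _ iha ihb => exact add_mem iha ihb
  obtain ⟨r, hr, hr0⟩ :=
    Submodule.exists_sub_one_mem_and_smul_eq_zero_of_fg_of_le_smul e N hN hle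
  have hz : LinearMap.mulLeft ℚ (r : K) = 0 := by
    apply LinearMap.ext_on hI'
    intro n hn
    exact hr0 n hn
  have hr1 : (r : K) = 0 := by simpa using congrArg (fun f => f 1) hz
  have hr2 : (r : K) - 1 ∈ E := hr
  rw [hr1, zero_sub] at hr2
  simpa using E.neg_mem hr2

/-- Let `R` be an order in an étale `ℚ`-algebra `K`.  Then `R` is a
Bass order — every over-order `S` of `R` (an order with `R ⊆ S ⊆ K`, equivalently a
fractional `R`-ideal that is a subring of `K`) is Gorenstein, i.e. `S^t·(S:S^t) = S` —
if and only if the ideal class monoid `ICM(R)` is a Clifford monoid (a disjoint union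
of groups); concretely, if and only if for every fractional `R`-ideal `I` there exist
a fractional `R`-ideal `J` and a unit `x ∈ K^×` such that `I = x·I²·J`. -/
theorem bass_iff_ICM_clifford
    [FiniteDimensional ℚ K] [IsReduced K]
    (hRfin : Module.Finite ℤ R) (hRspan : Submodule.span ℚ (R : Set K) = ⊤) :
    (∀ S : Submodule ↥R K, S.FG → Submodule.span ℚ (S : Set K) = ⊤ →
        (1 : K) ∈ S → S * S ≤ S →
        traceDualSub S * colonSub S (traceDualSub S) = S) ↔
      (∀ I : Submodule ↥R K, I.FG → Submodule.span ℚ (I : Set K) = ⊤ →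
        ∃ (J : Submodule ↥R K) (x : K), J.FG ∧ Submodule.span ℚ (J : Set K) = ⊤ ∧
          IsUnit x ∧ I = Submodule.map (LinearMap.mulLeft R x) (I * I * J)) := by
  constructor
  · intro H I hI hI'
    obtain ⟨hT, hT', hTT⟩ := aux_dual hRfin I hI hI'
    have hP := hI.mul hT
    have hP' := aux_span_mul I _ hI' hT'
    obtain ⟨hS, hS', hSS⟩ := aux_dual hRfin _ hP hP'
    have hSI : traceDualSub (I * traceDualSub I) = colonSub I I := by
      rw [mul_comm, aux_dual_mul, hTT]
    rw [hSI] at hS hS' hSS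
    have h1 : (1 : K) ∈ colonSub I I := fun y hy => by simpa using hy
    have hmul : colonSub I I * colonSub I I ≤ colonSub I I := by
      rw [Submodule.mul_le]
      intro a ha b hb y hy
      rw [mul_assoc]
      exact ha _ (hb y hy)
    have hG := H _ hS hS' h1 hmul
    have hC : colonSub (colonSub I I) (traceDualSub (colonSub I I)) =
        traceDualSub (traceDualSub (colonSub I I) * traceDualSub (colonSub I I)) := by
      rw [aux_dual_mul, hSS, hSI]
    have hQ : (traceDualSub (colonSub I I)).FG := by rw [hSS]; exact hP
    have hQ' : Submodule.span ℚ (traceDualSub (colonSub I I) : Set K) = ⊤ := by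
      rw [hSS]; exact hP'
    obtain ⟨hD, hD', -⟩ := aux_dual hRfin _ (hQ.mul hQ) (aux_span_mul _ _ hQ' hQ')
    rw [← hC] at hD hD'
    refine ⟨traceDualSub I * colonSub (colonSub I I) (traceDualSub (colonSub I I)), 1,
      hT.mul hD, aux_span_mul _ _ hT' hD', isUnit_one, ?_⟩
    have hone : Submodule.map (LinearMap.mulLeft R (1 : K)) = id := by
      funext M
      simp
    rw [hone, id]
    have : I * I * (traceDualSub I * colonSub (colonSub I I) (traceDualSub (colonSub I I))) =
        I * (I * traceDualSub I * colonSub (colonSub I I) (traceDualSub (colonSub I I))) := by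
      simp only [mul_assoc]
    rw [hSS] at hG ⊢
    rw [hSS] at this
    rw [this, hG]
    apply le_antisymm
    · intro y hy
      simpa using Submodule.mul_mem_mul hy h1
    · exact aux_colon_mul I I
  · intro H S hS hS' h1 hmul
    obtain ⟨hT, hT', hTT⟩ := aux_dual hRfin S hS hS'
    obtain ⟨J, x, -, -, -, hIJ⟩ := H _ hT hT'
    have hST : S * traceDualSub S ≤ traceDualSub S := by
      rw [Submodule.mul_le]
      intro a ha b hb y hy
      have := hb (a * y) (hmul (Submodule.mul_mem_mul ha hy))
      rwa [show a * b * y = b * (a * y) by ring]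
    have hIJ' : traceDualSub S =
        traceDualSub S * (Submodule.span R {x} * J) * traceDualSub S := by
      conv_lhs => rw [hIJ, aux_map]
      ac_rfl
    have hES : traceDualSub S * (Submodule.span R {x} * J) ≤ S := by
      intro z hz
      rw [← hTT]
      intro y hy
      have h2 : z * y ∈ traceDualSub S := by
        rw [hIJ']
        exact Submodule.mul_mem_mul hz hy
      simpa using h2 1 h1
    have h1E := aux_one_mem S (traceDualSub S) (traceDualSub S * (Submodule.span R {x} * J))
      h1 hmul hT hT' hST (by rw [← mul_assoc]; exact mul_le_mul_left hST _) hES hIJ'.le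
    apply le_antisymm (aux_colon_mul _ _)
    have hJ : Submodule.span R {x} * J ≤ colonSub S (traceDualSub S) := by
      intro a ha b hb
      apply hES
      rw [mul_comm a b]
      exact Submodule.mul_mem_mul hb ha
    intro s hs
    have h3 : s * 1 ∈ S * (traceDualSub S * (Submodule.span R {x} * J)) :=
      Submodule.mul_mem_mul hs h1E
    rw [mul_one, ← mul_assoc] at h3
    exact mul_le_mul' hST hJ h3
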